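/- arXiv:1106.2763 — 7 statements merged into one kernel-verified Lean document; each statement's English description precedes it below -/
import Mathlib

section
/- Let B be an integrally closed integral domain with fraction field F, let H be a finite-dimensional field extension of F, and let A be the integral closure of B in H. Let 𝔭 be a prime ideal of B such that the extended ideal 𝔭A is a prime ideal of A and 𝔭A ∩ B = 𝔭. Then for every y ∈ A, one has y ∈ 𝔭A if and only if N_{H/F}(y) (which lies in B because B is integrally closed) belongs to 𝔭. -/
/-- If `P` is a prime of an integral extension `A` of `B` and `P = 𝔭A` for `𝔭 = P ∩ B`, then `P` is
the only prime of `A` lying over `𝔭`. -/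
theorem Ideal.eq_map_of_comap_eq_of_isPrime_map {B A : Type*} [CommRing B] [CommRing A]
    [Algebra B A] [Algebra.IsIntegral B A] {p : Ideal B}
    (hmap : (p.map (algebraMap B A)).IsPrime)
    (hcap : (p.map (algebraMap B A)).comap (algebraMap B A) = p)
    {Q : Ideal A} (hQ : Q.comap (algebraMap B A) = p) :
    Q = p.map (algebraMap B A) := by
  have hle : p.map (algebraMap B A) ≤ Q := Ideal.map_le_iff_le_comap.mpr hQ.ge
  by_contra hne
  have hlt := Ideal.IsIntegral.comap_lt_comap (R := B) (lt_of_le_of_ne hle (Ne.symm hne))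
  rw [hcap, hQ] at hlt
  exact lt_irrefl _ hlt

/-- Over an algebraically closed field, the norm of an element of a finite extension is a positive
power of a product of conjugates of this element, and the product is nonempty. -/
theorem Algebra.exists_norm_eq_prod_conjugates_pow {F H : Type*} (E : Type*) [Field F] [Field H]
    [Field E] [Algebra F H] [Algebra F E] [FiniteDimensional F H] [IsAlgClosed E] (y : H) :
    ∃ (s : Multiset (H →ₐ[F] E)) (n : ℕ), s ≠ 0 ∧ n ≠ 0 ∧
      algebraMap F E (Algebra.norm F y) = (s.map fun σ ↦ σ y).prod ^ n := by
  have hroot (x : E) (hx : x ∈ (minpoly F y).aroots E) : ∃ σ : H →ₐ[F] E, σ y = x := by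
    have : x ∈ (minpoly F y).rootSet E := by
      classical
      rw [Polynomial.rootSet_def]
      exact Finset.mem_coe.mpr (Multiset.mem_toFinset.mpr hx)
    rwa [← Algebra.IsAlgebraic.range_eval_eq_rootSet_minpoly] at this
  have : CanLift E (H →ₐ[F] E) (fun σ ↦ σ y) fun x ↦ x ∈ (minpoly F y).aroots E :=
    ⟨hroot⟩
  have hlift : ∃ s : Multiset (H →ₐ[F] E), s.map (fun σ ↦ σ y) = (minpoly F y).aroots E :=
    CanLift.prf _ fun x hx ↦ hx
  obtain ⟨s, hs⟩ := hlift
  refine ⟨s, Module.finrank (IntermediateField.adjoin F {y}) H, ?_, Module.finrank_pos.ne', ?_⟩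
  · rintro rfl
    have hmem : (IsAlgClosed.lift : H →ₐ[F] E) y ∈ (minpoly F y).aroots E := by
      rw [Polynomial.mem_aroots]
      refine ⟨minpoly.ne_zero (Algebra.IsIntegral.isIntegral y), ?_⟩
      rw [Polynomial.aeval_algHom_apply, minpoly.aeval, map_zero]
    simp [← hs] at hmem
  · rw [hs]
    exact Algebra.norm_eq_prod_roots E (IsAlgClosed.splits _)

/-- Let `B` be an integrally closed domain with fraction field `F`, `H` a finite
extension of `F`, and `A` the integral closure of `B` in `H`. If `𝔭` is a prime
ideal of `B` such that `𝔭A` is prime and `𝔭A ∩ B = 𝔭`, then for `y ∈ A` we have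
`y ∈ 𝔭A` iff `N_{H/F}(y)` belongs to `𝔭` (as an element of `B` inside `F`). -/
theorem stmt3 {B F H : Type*} [CommRing B] [IsDomain B] [IsIntegrallyClosed B]
    [Field F] [Algebra B F] [IsFractionRing B F]
    [Field H] [Algebra F H] [FiniteDimensional F H]
    [Algebra B H] [IsScalarTower B F H]
    (p : Ideal B) (hp : p.IsPrime)
    (hmap : (p.map (algebraMap B (integralClosure B H))).IsPrime)
    (hcap : (p.map (algebraMap B (integralClosure B H))).comap
        (algebraMap B (integralClosure B H)) = p)
    (y : integralClosure B H) :
    y ∈ p.map (algebraMap B (integralClosure B H)) ↔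
      Algebra.norm F (y : H) ∈ (algebraMap B F) '' (p : Set B) := by
  have hBF : Function.Injective (algebraMap B F) := IsFractionRing.injective B F
  let E := AlgebraicClosure F
  have hBE : Function.Injective (algebraMap B E) := by
    rw [IsScalarTower.algebraMap_eq B F E]
    exact (algebraMap F E).injective.comp hBF
  have hBC : Function.Injective (algebraMap B (integralClosure B E)) := fun a b hab ↦
    hBE (congrArg Subtype.val hab)
  obtain ⟨Q, hQ, hQp⟩ := Ideal.exists_ideal_over_prime_of_isIntegral_of_isDomain
    (S := integralClosure B E) p (((RingHom.injective_iff_ker_eq_bot _).mp hBC).trans_le bot_le)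
  let f (σ : H →ₐ[F] E) : integralClosure B H →ₐ[B] integralClosure B E :=
    (σ.restrictScalars B).mapIntegralClosure
  have hf (σ : H →ₐ[F] E) : f σ y ∈ Q ↔ y ∈ p.map (algebraMap B (integralClosure B H)) := by
    have hcomap : (Q.comap (f σ)).comap (algebraMap B (integralClosure B H)) = p := by
      rw [← hQp]
      ext b
      simp [Ideal.mem_comap]
    rw [← Ideal.eq_map_of_comap_eq_of_isPrime_map hmap hcap hcomap, Ideal.mem_comap]
  obtain ⟨b, hb⟩ := IsIntegrallyClosed.isIntegral_iff.mp (Algebra.isIntegral_norm F y.2)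
  obtain ⟨s, n, hs, hn, hnorm⟩ := Algebra.exists_norm_eq_prod_conjugates_pow (F := F) E (y : H)
  have hbC : algebraMap B (integralClosure B E) b = (s.map fun σ ↦ f σ y).prod ^ n := by
    apply Subtype.ext
    change algebraMap B E b = (integralClosure B E).val ((s.map fun σ ↦ f σ y).prod ^ n)
    rw [IsScalarTower.algebraMap_apply B F E, hb, hnorm, map_pow, map_multiset_prod,
      Multiset.map_map]
    rfl
  rw [← hb, hBF.mem_set_image, SetLike.mem_coe, ← hQp, Ideal.mem_comap, hbC,
    hQ.pow_mem_iff_mem n (Nat.pos_of_ne_zero hn), hQ.multiset_prod_mem_iff_exists_mem, hQp]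
  simp only [Multiset.mem_map, exists_exists_and_eq_and, hf]
  obtain ⟨σ, hσ⟩ := Multiset.exists_mem_of_ne_zero hs
  exact ⟨fun hy ↦ ⟨σ, hσ, hy⟩, fun ⟨_, _, hy⟩ ↦ hy⟩
end

section
/- Let B be an integrally closed integral domain with fraction field F, let K be a finite-dimensional field extension of F, and let A be the integral closure of B in K. Let p ∈ B be an element such that the ideal pA is a prime ideal of A. Then for every nonzero y ∈ A, one has y ∈ pA if and only if every coefficient, other than the leading coefficient, of the minimal polynomial of y over F (these coefficients lie in B because B is integrally closed) belongs to the ideal pB. -/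
/-- Let `B` be an integrally closed domain with fraction field `F`, `K` a finite
extension of `F`, and `A` the integral closure of `B` in `K`. Let `p ∈ B` be such
that `pA` is a prime ideal of `A`. Then for nonzero `y ∈ A`, `y ∈ pA` iff every
coefficient of the minimal polynomial of `y` over `F`, other than the leading one,
lies in the ideal `pB` (i.e. is of the form `p·b` with `b ∈ B`). -/
theorem stmt5 {B F K : Type*} [CommRing B] [IsDomain B] [IsIntegrallyClosed B]
    [Field F] [Algebra B F] [IsFractionRing B F]
    [Field K] [Algebra F K] [FiniteDimensional F K]
    [Algebra B K] [IsScalarTower B F K]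
    (p : B)
    (hp : (Ideal.span {algebraMap B (integralClosure B K) p}).IsPrime)
    (y : integralClosure B K) (hy : y ≠ 0) :
    y ∈ Ideal.span {algebraMap B (integralClosure B K) p} ↔
      ∀ i < (minpoly F (y : K)).natDegree,
        ∃ b : B, (minpoly F (y : K)).coeff i = algebraMap B F (p * b) := by
  have htf : Module.IsTorsionFree B K := Module.IsTorsionFree.trans_faithfulSMul B F K
  have hint : IsIntegral B (y : K) := y.2
  have hmin : minpoly F (y : K) = (minpoly B (y : K)).map (algebraMap B F) :=
    minpoly.isIntegrallyClosed_eq_field_fractions' F hint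
  have hinj : Function.Injective (algebraMap B F) := IsFractionRing.injective B F
  have hdeg : (minpoly F (y : K)).natDegree = (minpoly B (y : K)).natDegree := by
    rw [hmin, Polynomial.natDegree_map_eq_of_injective hinj]
  have hcoeff : (∀ i < (minpoly F (y : K)).natDegree,
        ∃ b : B, (minpoly F (y : K)).coeff i = algebraMap B F (p * b)) ↔
      (minpoly B (y : K)).IsWeaklyEisensteinAt (Ideal.span {p}) := by
    rw [Polynomial.isWeaklyEisensteinAt_iff, hdeg, hmin]
    simp only [Polynomial.coeff_map, hinj.eq_iff, Ideal.mem_span_singleton, dvd_def]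
  rw [hcoeff]
  constructor
  · rw [Ideal.mem_span_singleton]
    rintro ⟨z, rfl⟩
    have hp0 : p ≠ 0 := by
      rintro rfl
      simp at hy
    have hz : ((algebraMap B (integralClosure B K) p * z : integralClosure B K) : K) =
        p • (z : K) := by
      rw [← Algebra.smul_def]; rfl
    have hscale : minpoly B (p • (z : K)) = (minpoly B (z : K)).scaleRoots p :=
      IsIntegrallyClosed.minpoly_smul hp0 z.2
    rw [hz, hscale]
    exact Polynomial.scaleRoots.isWeaklyEisensteinAt _ (Ideal.mem_span_singleton_self p)
  · intro hE
    have hroot : Polynomial.aeval y (minpoly B (y : K)) = 0 := by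
      apply Subtype.ext
      rw [Polynomial.aeval_subalgebra_coe]
      exact minpoly.aeval B (y : K)
    have hpow := hE.pow_natDegree_le_of_aeval_zero_of_monic_mem_map hroot
      (minpoly.monic hint) _ le_rfl
    rw [Ideal.map_span, Set.image_singleton] at hpow
    exact hp.mem_of_pow_mem _ hpow
end

section
/- Let G be a field and F = G(X) the field of rational functions in one variable over G. Let P ∈ G[X] be a polynomial of degree d ≥ 1 and Q ∈ G[T] a polynomial of degree m ≥ 1 with gcd(d, m) = 1. Then the polynomial Q(T) − P(X), viewed as a polynomial in T with coefficients in G(X), is irreducible over G(X); equivalently, any root α of Q(T) − P(X) in an algebraic closure of G(X) satisfies [G(X)(α) : G(X)] = m. -/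
open Polynomial

/-- An irreducible polynomial stays irreducible over a finite extension of coprime degree. -/
theorem Irreducible.map_of_coprime_finrank {K L : Type*} [Field K] [Field L] [Algebra K L]
    [FiniteDimensional K L] {p : K[X]} (hp : Irreducible p)
    (h : (Module.finrank K L).Coprime p.natDegree) :
    Irreducible (p.map (algebraMap K L)) := by
  have hp0 : p.map (algebraMap K L) ≠ 0 := Polynomial.map_ne_zero hp.ne_zero
  obtain ⟨g, hg, hgp⟩ := exists_irreducible_of_natDegree_pos
    (f := p.map (algebraMap K L)) (by rw [natDegree_map]; exact hp.natDegree_pos)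
  have := Fact.mk hg
  have : FiniteDimensional L (AdjoinRoot g) := (AdjoinRoot.powerBasis hg.ne_zero).finite
  have : FiniteDimensional K (AdjoinRoot g) := FiniteDimensional.trans K L (AdjoinRoot g)
  have hfin : Module.finrank L (AdjoinRoot g) = g.natDegree := by
    rw [(AdjoinRoot.powerBasis hg.ne_zero).finrank, AdjoinRoot.powerBasis_dim]
  have hroot : aeval (AdjoinRoot.root g) p = 0 := by
    rw [← aeval_map_algebraMap L]
    exact aeval_eq_zero_of_dvd_aeval_eq_zero hgp (by simp [AdjoinRoot.aeval_eq])
  have hmin : (minpoly K (AdjoinRoot.root g)).natDegree = p.natDegree := by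
    rw [← minpoly.eq_of_irreducible hp hroot, natDegree_mul_C]
    simpa using hp.ne_zero
  have hdvd : p.natDegree ∣ Module.finrank K L * g.natDegree := by
    rw [← hmin, ← hfin, Module.finrank_mul_finrank]
    exact minpoly.degree_dvd (Algebra.IsIntegral.isIntegral _)
  have hle : p.natDegree ≤ g.natDegree :=
    Nat.le_of_dvd hg.natDegree_pos (h.symm.dvd_of_dvd_mul_left hdvd)
  exact (associated_of_dvd_of_natDegree_le hgp hp0 (by rwa [natDegree_map])).irreducible hg

/-- The generic translate `Q(T) - X` of a nonconstant polynomial is irreducible over `G(X)`. -/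
theorem irreducible_map_sub_C_ratFuncX {G : Type*} [Field G] {Q : G[X]} (hQ : Q.natDegree ≠ 0) :
    Irreducible (Q.map (algebraMap G (RatFunc G)) - C (RatFunc.X : RatFunc G)) := by
  have hirr : Irreducible (Q.map C - C X : G[X][X]) := by
    have hlin : Irreducible (C Q - X : G[X][X]) := by
      have := irreducible_C_mul_X_add_C (a := (-1 : G[X])) (b := Q) (by simp)
        isUnit_one.neg.isRelPrime_left
      rwa [C_neg, C_1, neg_one_mul, neg_add_eq_sub] at this
    have : Q.map C - C X = Bivariate.swap (C Q - X : G[X][X]) := by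
      rw [map_sub, Bivariate.swap_C, Bivariate.swap_Y]
    rw [this, MulEquiv.irreducible_iff]
    exact hlin
  have hdeg : (Q.map C - C X : G[X][X]).natDegree ≠ 0 := by
    rwa [natDegree_sub_C, natDegree_map_eq_of_injective C_injective]
  have := ((hirr.isPrimitive hdeg).irreducible_iff_irreducible_map_fraction_map
    (K := RatFunc G)).mp hirr
  convert! this using 1
  simp [Polynomial.map_map, ← RatFunc.algebraMap_X]

theorem irreducible_map_sub_C_adjoinSimple_gen {G E : Type*} [Field G] [Field E] [Algebra G E]
    {f : E} (hf : Transcendental G f) {Q : G[X]} (hQ : Q.natDegree ≠ 0) :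
    Irreducible (Q.map (algebraMap G (IntermediateField.adjoin G {f})) -
      C (IntermediateField.AdjoinSimple.gen G f)) := by
  let e := RatFunc.algEquivOfTranscendental f hf
  have := (MulEquiv.irreducible_iff (mapEquiv e.toRingEquiv)).mpr
    (irreducible_map_sub_C_ratFuncX hQ)
  convert! this using 1
  have hX : e RatFunc.X = IntermediateField.AdjoinSimple.gen G f := by
    rw [← RatFunc.algebraMap_X]
    ext
    simp [e]
  have hc : e.toRingEquiv.toRingHom.comp (algebraMap G (RatFunc G)) = algebraMap G _ := by
    ext x : 1
    exact e.commutes x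
  rw [mapEquiv_apply, Polynomial.map_sub, Polynomial.map_map, map_C, ← hX, ← hc]
  rfl

/-- Let `G` be a field, `F = G(X)` the rational function field. If `P ∈ G[X]` has
degree `d ≥ 1`, `Q ∈ G[T]` has degree `m ≥ 1`, and `gcd(d, m) = 1`, then
`Q(T) − P(X)`, viewed as a polynomial in `T` over `G(X)`, is irreducible. -/
theorem stmt7 {G : Type*} [Field G] (P Q : Polynomial G) (d m : ℕ)
    (hPd : P.natDegree = d) (hd : 1 ≤ d)
    (hQm : Q.natDegree = m) (hm : 1 ≤ m)
    (hcop : Nat.Coprime d m) :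
    Irreducible
      (Q.map ((algebraMap (Polynomial G) (RatFunc G)).comp Polynomial.C) -
        Polynomial.C (algebraMap (Polynomial G) (RatFunc G) P)) := by
  set f := algebraMap G[X] (RatFunc G) P with hf
  have hrank : Module.finrank (IntermediateField.adjoin G {f}) (RatFunc G) = d := by
    rw [RatFunc.finrank_eq_max_natDegree, hf, RatFunc.num_algebraMap, RatFunc.denom_algebraMap,
      hPd, natDegree_one, Nat.max_zero]
  have hnC : ¬∃ c, f = RatFunc.C c := by
    rw [RatFunc.eq_C_iff, hf, RatFunc.num_algebraMap]
    omega
  have : FiniteDimensional (IntermediateField.adjoin G {f}) (RatFunc G) :=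
    Module.finite_of_finrank_pos (by omega)
  have hirr := irreducible_map_sub_C_adjoinSimple_gen (RatFunc.transcendental_of_ne_C f hnC)
    (Q := Q) (by omega)
  have := hirr.map_of_coprime_finrank (L := RatFunc G) (by
    rwa [natDegree_sub_C, natDegree_map, hrank, hQm])
  convert! this using 1
  rw [Polynomial.map_sub, Polynomial.map_map, map_C,
    IntermediateField.AdjoinSimple.algebraMap_gen]
  rfl
end

section
/- Let K be a number field with ring of integers O_K. Then there are infinitely many nonzero prime ideals 𝔭 of O_K such that the equation Z³ = 4 has a solution in the residue field O_K/𝔭; that is, infinitely many maximal ideals 𝔭 of O_K for which there exists z ∈ O_K with z³ ≡ 4 (mod 𝔭). -/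
open scoped Nat in
theorem infinite_primes_dvd_cube_sub_four :
    {q : ℕ | q.Prime ∧ ∃ z : ℤ, (q : ℤ) ∣ z ^ 3 - 4}.Infinite := by
  refine Set.infinite_of_not_bddAbove fun ⟨n, hn⟩ ↦ ?_
  have hpos : 1 ≤ (n + 2)! := Nat.factorial_pos _
  have hne : 2 * (n + 2)! ^ 3 - 1 ≠ 1 := by
    have h2 : 2 ≤ (n + 2)! := (by omega : 2 ≤ n + 2).trans (Nat.self_le_factorial _)
    have h8 : 2 ^ 3 ≤ (n + 2)! ^ 3 := Nat.pow_le_pow_left h2 3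
    omega
  obtain ⟨q, hq, m, hm⟩ := Nat.exists_prime_and_dvd hne
  have hm' : 2 * (n + 2)! ^ 3 = q * m + 1 := by
    have : 1 ≤ (n + 2)! ^ 3 := Nat.one_le_pow _ _ hpos
    omega
  have hqn : q ≤ n := hn ⟨hq, 2 * ((n + 2)! : ℤ), 4 * m, by
    have h : 2 * ((n + 2)! : ℤ) ^ 3 = q * m + 1 := by exact_mod_cast hm'
    linear_combination 4 * h⟩
  have hdvd : q ∣ (n + 2)! := hq.dvd_factorial.mpr (by omega)
  have hdvd1 : q ∣ q * m + 1 := hm' ▸ (hdvd.pow three_ne_zero).mul_left 2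
  exact hq.not_dvd_one ((Nat.dvd_add_right (dvd_mul_right q m)).mp hdvd1)

theorem exists_isMaximal_natCast_mem (K : Type*) [Field K] [NumberField K] {q : ℕ}
    (hq : q.Prime) :
    ∃ p : Ideal (NumberField.RingOfIntegers K), p.IsMaximal ∧
      (q : NumberField.RingOfIntegers K) ∈ p := by
  refine exists_max_ideal_of_mem_nonunits fun hu ↦ ?_
  have h := hu.map (Algebra.norm ℤ)
  rw [← map_natCast (algebraMap ℤ (NumberField.RingOfIntegers K)), Algebra.norm_algebraMap,
    isUnit_pow_iff Module.finrank_pos.ne'] at h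
  exact (Nat.prime_iff_prime_int.mp hq).not_isUnit h

theorem Ideal.eq_of_prime_natCast_mem {R : Type*} [CommRing R] {p : Ideal R} (hp : p ≠ ⊤)
    {q r : ℕ} (hq : q.Prime) (hr : r.Prime) (hqp : (q : R) ∈ p) (hrp : (r : R) ∈ p) :
    q = r := by
  by_contra hne
  obtain ⟨a, b, hab⟩ := Nat.Coprime.cast (R := R) ((Nat.coprime_primes hq hr).mpr hne)
  exact hp ((Ideal.eq_top_iff_one p).mpr
    (hab ▸ p.add_mem (p.mul_mem_left a hqp) (p.mul_mem_left b hrp)))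

/-- For a number field `K` with ring of integers `O_K`, there are infinitely many
maximal ideals `𝔭` of `O_K` in whose residue field the equation `Z³ = 4` has a
solution, i.e. with `z³ ≡ 4 (mod 𝔭)` for some `z ∈ O_K`. -/
theorem stmt8 (K : Type*) [Field K] [NumberField K] :
    {p : Ideal (NumberField.RingOfIntegers K) |
      p.IsMaximal ∧ ∃ z : NumberField.RingOfIntegers K, z ^ 3 - 4 ∈ p}.Infinite := by
  choose! P hmax hmem using fun (q : ℕ) (hq : q.Prime) ↦ exists_isMaximal_natCast_mem K hq
  refine (infinite_primes_dvd_cube_sub_four.image (f := P) ?_).mono ?_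
  · rintro q ⟨hq, -⟩ r ⟨hr, -⟩ h
    exact Ideal.eq_of_prime_natCast_mem (hmax q hq).ne_top hq hr (hmem q hq)
      (h ▸ hmem r hr)
  · rintro _ ⟨q, ⟨hq, z, m, hm⟩, rfl⟩
    refine ⟨hmax q hq, z, ?_⟩
    have h : (z : NumberField.RingOfIntegers K) ^ 3 - 4 = q * m := by
      exact_mod_cast congrArg Int.cast hm
    exact h ▸ (P q).mul_mem_right _ (hmem q hq)
end

section
/- Let K be a number field with ring of integers O_K. Let S be a finite set of nonzero prime ideals of O_K none of which contains 3, and let 𝔮 ∉ S be a nonzero prime ideal of O_K not containing 6 such that 4 is a cube in the residue field O_K/𝔮. Then there exists A ∈ O_K such that 4A³ + 27 ≠ 0, 4A³ + 27 ∈ 𝔮, and 4A³ + 27 ∉ 𝔭 for every 𝔭 ∈ S. -/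
theorem NumberField.RingOfIntegers.four_mul_ne_one (K : Type*) [Field K] [NumberField K]
    (b : NumberField.RingOfIntegers K) : 4 * b ≠ 1 := by
  intro h
  have hn := congrArg (Algebra.norm ℤ) h
  rw [map_mul, map_one] at hn
  have h4 : Algebra.norm ℤ (4 : NumberField.RingOfIntegers K) =
      4 ^ Module.finrank ℤ (NumberField.RingOfIntegers K) := by
    simpa using Algebra.norm_algebraMap (S := NumberField.RingOfIntegers K) (4 : ℤ)
  have hpos : Module.finrank ℤ (NumberField.RingOfIntegers K) ≠ 0 := Module.finrank_pos.ne'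
  rw [h4] at hn
  have hu : IsUnit ((4 : ℤ) ^ Module.finrank ℤ (NumberField.RingOfIntegers K)) :=
    IsUnit.of_mul_eq_one _ hn
  rw [isUnit_pow_iff hpos, Int.isUnit_iff] at hu
  omega


/-- Let `K` be a number field, `S` a finite set of nonzero prime ideals of `O_K`
none containing `3`, and `𝔮 ∉ S` a nonzero prime of `O_K` not containing `6` such
that `4` is a cube mod `𝔮`. Then there is `A ∈ O_K` with `4A³ + 27 ≠ 0`,
`4A³ + 27 ∈ 𝔮`, and `4A³ + 27 ∉ 𝔭` for all `𝔭 ∈ S`. -/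
theorem stmt9 (K : Type*) [Field K] [NumberField K]
    (S : Finset (Ideal (NumberField.RingOfIntegers K)))
    (hS : ∀ p ∈ S, p ≠ ⊥ ∧ p.IsPrime ∧ (3 : NumberField.RingOfIntegers K) ∉ p)
    (q : Ideal (NumberField.RingOfIntegers K)) (hqS : q ∉ S) (hq0 : q ≠ ⊥)
    (hq : q.IsPrime) (hq6 : (6 : NumberField.RingOfIntegers K) ∉ q)
    (hcube : ∃ z : NumberField.RingOfIntegers K, z ^ 3 - 4 ∈ q) :
    ∃ A : NumberField.RingOfIntegers K,
      4 * A ^ 3 + 27 ≠ 0 ∧ 4 * A ^ 3 + 27 ∈ q ∧ ∀ p ∈ S, 4 * A ^ 3 + 27 ∉ p := by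
  obtain ⟨z, hz⟩ := hcube
  have hqmax : q.IsMaximal := hq.isMaximal hq0
  have hzq : z ∉ q := by
    intro h
    have h4 : (4 : NumberField.RingOfIntegers K) ∈ q := by
      have := q.sub_mem (q.mul_mem_left (z ^ 2) h) hz
      ring_nf at this
      exact this
    have h2 : (2 : NumberField.RingOfIntegers K) ∈ q := by
      refine hq.mem_of_pow_mem 2 ?_
      norm_num
      exact h4
    apply hq6
    have := q.mul_mem_left 3 h2
    norm_num at this
    exact this
  obtain ⟨w, i, hi, hw⟩ := hqmax.exists_inv hzq
  have hcop : IsCoprime q (∏ p ∈ S, p) := by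
    refine IsCoprime.prod_right fun p hp => ?_
    obtain ⟨hp0, hpp, -⟩ := hS p hp
    rw [Ideal.isCoprime_iff_sup_eq]
    exact hqmax.coprime_of_ne (hpp.isMaximal hp0) fun h => hqS (h ▸ hp)
  obtain ⟨x, hx, j, hj, hxj⟩ := Ideal.isCoprime_iff_exists.mp hcop
  refine ⟨-3 * w * j, fun h => ?_, ?_, fun p hp h => ?_⟩
  · exact NumberField.RingOfIntegers.four_mul_ne_one K (7 + (-3 * w * j) ^ 3)
      (by linear_combination h)
  · have hu : 1 - (w * z) ^ 3 ∈ q := by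
      have := q.mul_mem_left (1 + w * z + (w * z) ^ 2) hi
      convert this using 1
      linear_combination (-(1 + w * z + (w * z) ^ 2)) * hw
    have hv : 1 - j ^ 3 ∈ q := by
      convert q.mul_mem_left (1 + j + j ^ 2) hx using 1
      linear_combination (-(1 + j + j ^ 2)) * hxj
    convert q.add_mem (q.add_mem (q.mul_mem_left (27 * w ^ 3 * j ^ 3) hz)
      (q.mul_mem_left (27 * j ^ 3) hu)) (q.mul_mem_left 27 hv) using 1
    ring
  · obtain ⟨-, hpp, h3⟩ := hS p hp
    have hjp : j ∈ p := Ideal.le_of_dvd (Finset.dvd_prod_of_mem _ hp) hj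
    refine h3 (hpp.mem_of_pow_mem 3 ?_)
    convert p.sub_mem h (p.mul_mem_left (4 * (-3 * w) ^ 3 * j ^ 2) hjp) using 1
    ring
end

section
/- Let K be a number field with ring of integers O_K. Then there exists a sequence (A_i)_{i∈ℕ} of elements of O_K such that for every i, 4A_i³ + 27 ≠ 0 and 4A_i³ + 27 is not a unit of O_K, and for all i ≠ j the principal ideals of O_K generated by 4A_i³ + 27 and by 4A_j³ + 27 are coprime (their sum is the unit ideal; equivalently, no nonzero prime ideal of O_K divides both). -/
/-- A sequence of natural numbers, each term divisible by `4 * a ^ 3 + 27` for every earlier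
term `a`. -/
def coprimeSeq : ℕ → ℕ
  | 0 => 1
  | n + 1 => coprimeSeq n * (4 * coprimeSeq n ^ 3 + 27)

theorem coprime_three_value {a : ℕ} (h : Nat.Coprime a 3) : Nat.Coprime (4 * a ^ 3 + 27) 3 := by
  rw [show 4 * a ^ 3 + 27 = 4 * a ^ 3 + 3 * 9 by norm_num, Nat.coprime_add_mul_left_left]
  exact Nat.Coprime.mul_left (by norm_num) (h.pow_left 3)

theorem coprimeSeq_coprime_three (n : ℕ) : Nat.Coprime (coprimeSeq n) 3 := by
  induction n with
  | zero => simp [coprimeSeq]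
  | succ n ih => exact Nat.Coprime.mul_left ih (coprime_three_value ih)

theorem value_dvd_coprimeSeq {i j : ℕ} (h : i < j) :
    4 * coprimeSeq i ^ 3 + 27 ∣ coprimeSeq j := by
  induction j, h using Nat.le_induction with
  | base => exact dvd_mul_left _ _
  | succ j _ ih => exact ih.mul_right _

theorem coprime_values_of_lt {i j : ℕ} (h : i < j) :
    Nat.Coprime (4 * coprimeSeq i ^ 3 + 27) (4 * coprimeSeq j ^ 3 + 27) := by
  obtain ⟨k, hk⟩ := (value_dvd_coprimeSeq h).trans
    ((dvd_pow_self (coprimeSeq j) three_ne_zero).mul_left 4)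
  rw [hk, Nat.coprime_mul_left_add_right]
  exact (coprime_three_value (coprimeSeq_coprime_three i)).pow_right 3

theorem coprime_values {i j : ℕ} (h : i ≠ j) :
    Nat.Coprime (4 * coprimeSeq i ^ 3 + 27) (4 * coprimeSeq j ^ 3 + 27) :=
  h.lt_or_gt.elim coprime_values_of_lt fun h' => (coprime_values_of_lt h').symm

theorem NumberField.RingOfIntegers.isUnit_natCast_iff (K : Type*) [Field K] [NumberField K]
    {n : ℕ} : IsUnit (n : NumberField.RingOfIntegers K) ↔ n = 1 := by
  have : IsUnit (algebraMap ℤ (NumberField.RingOfIntegers K) n) ↔ IsUnit (n : ℤ) :=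
    isUnit_map_iff _ _
  rw [← Int.ofNat_isUnit.trans Nat.isUnit_iff, ← this]
  simp

/-- For a number field `K` with ring of integers `O_K`, there is a sequence
`(A_i)` in `O_K` with every `4A_i³ + 27` nonzero and not a unit, such that for
`i ≠ j` the principal ideals generated by `4A_i³ + 27` and `4A_j³ + 27` are
coprime (their sum is the unit ideal). -/
theorem stmt10 (K : Type*) [Field K] [NumberField K] :
    ∃ A : ℕ → NumberField.RingOfIntegers K,
      (∀ i, 4 * A i ^ 3 + 27 ≠ 0 ∧ ¬IsUnit (4 * A i ^ 3 + 27)) ∧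
      ∀ i j, i ≠ j →
        Ideal.span {4 * A i ^ 3 + 27} ⊔ Ideal.span {4 * A j ^ 3 + 27} =
          (⊤ : Ideal (NumberField.RingOfIntegers K)) := by
  have cast_value (i : ℕ) : 4 * (coprimeSeq i : NumberField.RingOfIntegers K) ^ 3 + 27 =
      ((4 * coprimeSeq i ^ 3 + 27 : ℕ) : NumberField.RingOfIntegers K) := by
    push_cast
    rfl
  refine ⟨fun i => coprimeSeq i, fun i => ?_, fun i j hij => ?_⟩
  · rw [cast_value, Nat.cast_ne_zero, NumberField.RingOfIntegers.isUnit_natCast_iff]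
    omega
  · rw [cast_value, cast_value, ← Ideal.isCoprime_iff_sup_eq, Ideal.isCoprime_span_singleton_iff]
    exact (coprime_values hij).cast
end

section
/- Let k be a field, n ≥ 1, and for each j ∈ {1,…,n} let S_j ⊆ k be a subset. Let P = { h ∈ k[x₁,…,xₙ] : for every j and every a ∈ S_j, the linear polynomial x_j − a does not divide h }, and let R = { g ∈ k(x₁,…,xₙ) : g = g₁/g₂ with g₁, g₂ ∈ k[x₁,…,xₙ] and g₂ ∈ P }, a subring of the rational function field. Then the prime ideals of R are exactly the zero ideal together with the ideals (x_j − a)R for j ∈ {1,…,n} and a ∈ S_j, and each ideal (x_j − a)R with a ∈ S_j is prime. -/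
open MvPolynomial in
/-- A linear polynomial `x_j − a` over a domain is prime. -/
theorem prime_X_sub_C {σ k : Type*} [CommRing k] [IsDomain k] (j : σ) (a : k) :
    Prime (X j - C a : MvPolynomial σ k) := by
  let e : MvPolynomial σ k ≃ₐ[k] MvPolynomial σ k :=
    AlgEquiv.ofAlgHom (aeval fun i => X i - C a) (aeval fun i => X i + C a)
      (by ext i : 1; simp [algebraMap_eq]) (by ext i : 1; simp [algebraMap_eq])
  have he : e (X j) = X j - C a := by simp [e]
  rw [← he, MulEquiv.prime_iff]
  exact X_prime

open MvPolynomial in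
/-- A sum of linear polynomials in two distinct variables vanishes on no hyperplane `x_l = c`. -/
theorem not_X_sub_C_dvd_add {σ k : Type*} [CommRing k] [Nontrivial k] {i j : σ} (hij : i ≠ j)
    (a b : k) (l : σ) (c : k) :
    ¬ (X l - C c : MvPolynomial σ k) ∣ (X i - C a) + (X j - C b) := by
  classical
  rintro ⟨q, hq⟩
  obtain ⟨m, hml, hsum⟩ : ∃ m, m ≠ l ∧
      ∀ v : σ → k, v i + v j = v m + v (if m = i then j else i) := by
    by_cases h : i = l
    · exact ⟨j, fun h' => hij (h.trans h'.symm), fun v => by simp [hij.symm, add_comm]⟩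
    · exact ⟨i, h, fun v => by simp⟩
  have hother : (if m = i then j else i) ≠ m := by
    split_ifs with h
    · exact fun h' => hij (h.symm.trans h'.symm)
    · exact fun h' => h h'.symm
  let v : σ → k := Function.update (fun _ => c) m (a + b - c + 1)
  have hv := congrArg (eval v) hq
  have hs := hsum v
  have h1 : v m = a + b - c + 1 := by simp [v]
  have h2 : v (if m = i then j else i) = c := by simp only [v, Function.update_of_ne hother]
  have h3 : v l = c := by simp only [v, Function.update_of_ne hml.symm]
  simp only [map_add, map_sub, map_mul, eval_X, eval_C, h3, sub_self, zero_mul] at hv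
  rw [h1, h2] at hs
  exact one_ne_zero (α := k) (by linear_combination hv - hs)

open MvPolynomial in
/-- If all nonzero polynomials divisible by no `x_j − a` with `a ∈ S j` avoid the prime ideal `Q`,
then every nonzero element of `Q` is divisible by some `x_j − a` in `Q` with `a ∈ S j`. -/
theorem exists_X_sub_C_mem_dvd {σ k : Type*} [Field k] {S : σ → Set k}
    {Q : Ideal (MvPolynomial σ k)} [Q.IsPrime]
    (hQ : ∀ p ∈ Q, p ≠ 0 → ∃ j, ∃ a ∈ S j, X j - C a ∣ p) :
    ∀ f ∈ Q, f ≠ 0 → ∃ j, ∃ a ∈ S j, X j - C a ∈ Q ∧ X j - C a ∣ f := by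
  intro f
  induction f using UniqueFactorizationMonoid.induction_on_prime with
  | h₁ => exact fun _ h => absurd rfl h
  | h₂ x hx => exact fun h _ => absurd (Q.eq_top_of_isUnit_mem h hx) Ideal.IsPrime.ne_top'
  | h₃ f p hf hp ih =>
    intro hmem _
    rcases Ideal.IsPrime.mem_or_mem ‹_› hmem with h | h
    · obtain ⟨j, a, ha, hdvd⟩ := hQ p h hp.ne_zero
      have hassoc := (prime_X_sub_C j a).associated_of_dvd hp hdvd
      exact ⟨j, a, ha, Q.mem_of_dvd hassoc.symm.dvd h, hdvd.mul_right f⟩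
    · obtain ⟨j, a, ha, hm, hdvd⟩ := ih h hf
      exact ⟨j, a, ha, hm, hdvd.mul_left p⟩

open MvPolynomial in
/-- A nonzero prime ideal of the polynomial ring all of whose nonzero elements are divisible by
some `x_j − a` with `a ∈ S j` is generated by one of these linear polynomials. -/
theorem exists_eq_span_X_sub_C {σ k : Type*} [Field k] {S : σ → Set k}
    {Q : Ideal (MvPolynomial σ k)} [Q.IsPrime] (hne : Q ≠ ⊥)
    (hQ : ∀ p ∈ Q, p ≠ 0 → ∃ j, ∃ a ∈ S j, X j - C a ∣ p) :
    ∃ j, ∃ a ∈ S j, Q = Ideal.span {X j - C a} := by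
  obtain ⟨f, hf, hf0⟩ := Submodule.exists_mem_ne_zero_of_ne_bot hne
  obtain ⟨j, a, ha, hm, -⟩ := exists_X_sub_C_mem_dvd hQ f hf hf0
  refine ⟨j, a, ha, le_antisymm (fun g hg => ?_) (Q.span_singleton_le_iff_mem.2 hm)⟩
  rw [Ideal.mem_span_singleton]
  by_cases hg0 : g = 0
  · exact hg0 ▸ dvd_zero _
  obtain ⟨i, b, -, hm', hdvd⟩ := exists_X_sub_C_mem_dvd hQ g hg hg0
  by_cases hij : i = j
  · subst hij
    by_cases hab : b = a
    · exact hab ▸ hdvd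
    · have hC : C (b - a) ∈ Q := by
        have := Q.sub_mem hm hm'
        rwa [sub_sub_sub_cancel_left, ← C_sub] at this
      exact absurd (Q.eq_top_of_isUnit_mem hC ((sub_ne_zero.2 hab).isUnit.map C))
        Ideal.IsPrime.ne_top'
  · have hmem := Q.add_mem hm' hm
    have hne0 : (X i - C b) + (X j - C a) ≠ (0 : MvPolynomial σ k) := fun h =>
      not_X_sub_C_dvd_add hij b a j a (h ▸ dvd_zero _)
    obtain ⟨l, c, -, hl⟩ := hQ _ hmem hne0
    exact absurd hl (not_X_sub_C_dvd_add hij b a l c)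


/-- Let `k` be a field, `n ≥ 1`, and `S_j ⊆ k` for each `j`. Let
`P = {h ∈ k[x₁,…,xₙ] : no x_j − a with a ∈ S_j divides h}` and let `R` be the
subring `{g₁/g₂ : g₂ ∈ P}` of `k(x₁,…,xₙ)`. Then the prime ideals of `R` are
exactly the zero ideal together with the ideals `(x_j − a)R` for `a ∈ S_j`, and
each `(x_j − a)R` with `a ∈ S_j` is prime. -/
theorem stmt12 {k : Type*} [Field k] {n : ℕ} (hn : 1 ≤ n) (S : Fin n → Set k)
    (R : Subring (FractionRing (MvPolynomial (Fin n) k)))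
    (hR : ∀ g, g ∈ R ↔ ∃ g₁ g₂ : MvPolynomial (Fin n) k,
        (∀ j : Fin n, ∀ a ∈ S j, ¬ (MvPolynomial.X j - MvPolynomial.C a ∣ g₂)) ∧
        g = algebraMap (MvPolynomial (Fin n) k) (FractionRing (MvPolynomial (Fin n) k)) g₁ /
            algebraMap (MvPolynomial (Fin n) k) (FractionRing (MvPolynomial (Fin n) k)) g₂) :
    ((⊥ : Ideal R).IsPrime ∧
      ∀ j : Fin n, ∀ a ∈ S j,
        (Ideal.span {x : R | (x : FractionRing (MvPolynomial (Fin n) k)) =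
            algebraMap (MvPolynomial (Fin n) k) (FractionRing (MvPolynomial (Fin n) k))
              (MvPolynomial.X j - MvPolynomial.C a)}).IsPrime) ∧
    ∀ I : Ideal R, I.IsPrime →
      I = ⊥ ∨ ∃ j : Fin n, ∃ a ∈ S j,
        I = Ideal.span {x : R | (x : FractionRing (MvPolynomial (Fin n) k)) =
            algebraMap (MvPolynomial (Fin n) k) (FractionRing (MvPolynomial (Fin n) k))
              (MvPolynomial.X j - MvPolynomial.C a)} := by
  let K := FractionRing (MvPolynomial (Fin n) k)
  have hinj : Function.Injective (algebraMap (MvPolynomial (Fin n) k) K) :=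
    IsFractionRing.injective _ _
  have hone : ∀ j : Fin n, ∀ a ∈ S j,
      ¬ (MvPolynomial.X j - MvPolynomial.C a ∣ (1 : MvPolynomial (Fin n) k)) :=
    fun j a _ => (prime_X_sub_C j a).not_dvd_one
  let φ : MvPolynomial (Fin n) k →+* R := (algebraMap (MvPolynomial (Fin n) k) K).codRestrict R
    fun f => (hR _).2 ⟨f, 1, hone, by simp [K]⟩
  have hφ : ∀ f, (φ f : K) = algebraMap (MvPolynomial (Fin n) k) K f := fun _ => rfl
  have hφinj : Function.Injective φ := fun x y h => hinj (congrArg Subtype.val h)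
  have hunit : ∀ p : MvPolynomial (Fin n) k, p ≠ 0 →
      (∀ j : Fin n, ∀ a ∈ S j, ¬ (MvPolynomial.X j - MvPolynomial.C a ∣ p)) →
      IsUnit (φ p) := by
    intro p hp0 hp
    have hp0' : algebraMap (MvPolynomial (Fin n) k) K p ≠ 0 := by
      rwa [Ne, map_eq_zero_iff _ hinj]
    refine IsUnit.of_mul_eq_one ⟨1 / algebraMap (MvPolynomial (Fin n) k) K p,
      (hR _).2 ⟨1, p, hp, by simp [K]⟩⟩ (Subtype.ext ?_)
    exact mul_one_div_cancel hp0'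
  have hrep : ∀ r : R, ∃ g₁ g₂ : MvPolynomial (Fin n) k, g₂ ≠ 0 ∧
      (∀ j : Fin n, ∀ a ∈ S j, ¬ (MvPolynomial.X j - MvPolynomial.C a ∣ g₂)) ∧
      r * φ g₂ = φ g₁ := by
    intro r
    obtain ⟨g₁, g₂, hg₂, hr⟩ := (hR r).1 r.2
    by_cases h0 : g₂ = 0
    · refine ⟨0, 1, one_ne_zero, hone, Subtype.ext ?_⟩
      rw [h0, map_zero, div_zero] at hr
      simp [hr]
    · refine ⟨g₁, g₂, h0, hg₂, Subtype.ext ?_⟩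
      rw [Subring.coe_mul, hφ, hφ, hr]
      exact div_mul_cancel₀ _ (by rwa [Ne, map_eq_zero_iff _ hinj])
  have hdvd : ∀ j : Fin n, ∀ a ∈ S j, ∀ f,
      φ (MvPolynomial.X j - MvPolynomial.C a) ∣ φ f → MvPolynomial.X j - MvPolynomial.C a ∣ f := by
    rintro j a ha f ⟨t, ht⟩
    obtain ⟨u₁, u₂, -, hu₂, hu⟩ := hrep t
    have h : f * u₂ = (MvPolynomial.X j - MvPolynomial.C a) * u₁ := hφinj <| by
      rw [map_mul, map_mul, ht, mul_assoc, hu]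
    exact ((prime_X_sub_C j a).dvd_or_dvd ⟨u₁, h⟩).resolve_right (hu₂ j a ha)
  have hset : ∀ (j : Fin n) (a : k), {x : R | (x : K) =
      algebraMap (MvPolynomial (Fin n) k) K (MvPolynomial.X j - MvPolynomial.C a)} =
      {φ (MvPolynomial.X j - MvPolynomial.C a)} := by
    intro j a
    ext x
    rw [Set.mem_ofPred_eq, Set.mem_singleton_iff, Subtype.ext_iff, hφ]
  refine ⟨⟨Ideal.isPrime_bot, fun j a ha => ?_⟩, fun I hI => ?_⟩
  · rw [hset, Ideal.span_singleton_prime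
      ((map_ne_zero_iff _ hφinj).2 (prime_X_sub_C j a).ne_zero)]
    refine ⟨(map_ne_zero_iff _ hφinj).2 (prime_X_sub_C j a).ne_zero, fun h => ?_, fun r s h => ?_⟩
    · exact hone j a ha (hdvd j a ha 1 h.dvd)
    · obtain ⟨g₁, g₂, hg0, hg₂, hg⟩ := hrep r
      obtain ⟨h₁, h₂, hh0, hh₂, hh⟩ := hrep s
      have : φ (MvPolynomial.X j - MvPolynomial.C a) ∣ φ (g₁ * h₁) := by
        rw [map_mul, ← hg, ← hh, mul_mul_mul_comm]
        exact h.mul_right _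
      refine ((prime_X_sub_C j a).dvd_or_dvd (hdvd j a ha _ this)).imp (fun h' => ?_) fun h' => ?_
      · rw [← (hunit g₂ hg0 hg₂).dvd_mul_right, hg]
        exact map_dvd φ h'
      · rw [← (hunit h₂ hh0 hh₂).dvd_mul_right, hh]
        exact map_dvd φ h'
  · refine or_iff_not_imp_left.2 fun hne => ?_
    have hQ : ∀ p ∈ I.comap φ, p ≠ 0 →
        ∃ j, ∃ a ∈ S j, MvPolynomial.X j - MvPolynomial.C a ∣ p := by
      intro p hp hp0
      by_contra! h
      exact hI.ne_top (I.eq_top_of_isUnit_mem hp (hunit p hp0 h))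
    have hnum : ∀ r : R, ∀ g₁ g₂, r * φ g₂ = φ g₁ → r ∈ I → g₁ ∈ I.comap φ :=
      fun r g₁ g₂ h hr => by
        rw [Ideal.mem_comap, ← h]
        exact I.mul_mem_right _ hr
    have hQne : I.comap φ ≠ ⊥ := by
      obtain ⟨r, hr, hr0⟩ := Submodule.exists_mem_ne_zero_of_ne_bot hne
      obtain ⟨g₁, g₂, hg0, -, hg⟩ := hrep r
      refine (Submodule.ne_bot_iff _).2 ⟨g₁, hnum r g₁ g₂ hg hr, ?_⟩
      rw [← map_ne_zero_iff _ hφinj, ← hg]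
      exact mul_ne_zero hr0 ((map_ne_zero_iff _ hφinj).2 hg0)
    obtain ⟨j, a, ha, hspan⟩ := exists_eq_span_X_sub_C hQne hQ
    refine ⟨j, a, ha, ?_⟩
    rw [hset]
    refine le_antisymm (fun r hr => ?_) ?_
    · obtain ⟨g₁, g₂, hg0, hg₂, hg⟩ := hrep r
      have h := hnum r g₁ g₂ hg hr
      rw [hspan, Ideal.mem_span_singleton] at h
      rw [Ideal.mem_span_singleton, ← (hunit g₂ hg0 hg₂).dvd_mul_right, hg]
      exact map_dvd φ h
    · rw [Ideal.span_singleton_le_iff_mem, ← Ideal.mem_comap, hspan]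
      exact Ideal.mem_span_singleton_self _
end
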